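/- (One-step invariance of nonnegativity and probability conservation in Algorithm 1, inequalities (72)–(73) in the proof of Proposition 6.) Assume δ > 2Ū and set K = δ + √(δ(δ − 2Ū)). Let 0 < Δt < 1/(δ + K). Let m and Φ be matrices such that m_{i,j} ≥ 0 for all (i,j), Σ_{i=1}^{N_x} m_{i,j} = 1 for every j, and 0 ≤ Φ_{i,j} ≤ K for all (i,j). Define m'_{i,j} = m_{i,j} + Δt · F_{i,j}(m, Φ). Then m'_{i,j} ≥ 0 for all (i,j) and Σ_{i=1}^{N_x} m'_{i,j} = 1 for every j. -/

import Mathlib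

/-- Discretized Fokker–Planck operator:
`F_{i,j}(m, Φ) = δ (μ₀)_{i,j} − (δ − (Φ_{i,j} − Σ_k Φ_{k,j} m_{k,j})) m_{i,j}`. -/
def Fop {Nx Ny : ℕ} (δ : ℝ) (μ0 m Φ : Fin Nx → Fin Ny → ℝ)
    (i : Fin Nx) (j : Fin Ny) : ℝ :=
  δ * μ0 i j - (δ - (Φ i j - ∑ k, Φ k j * m k j)) * m i j

/-- **One-step invariance of nonnegativity and probability conservation in
Algorithm 1** (inequalities (72)–(73) in the proof of Proposition 6). -/
theorem stmt12
    (Nx Ny : ℕ) [NeZero Nx] [NeZero Ny]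
    (Ubar δ : ℝ) (hUbar : 0 < Ubar) (hδ : 2 * Ubar < δ)
    (K : ℝ) (hK : K = δ + Real.sqrt (δ * (δ - 2 * Ubar)))
    (Δt : ℝ) (hΔt0 : 0 < Δt) (hΔt : Δt < 1 / (δ + K))
    (μ0 : Fin Nx → Fin Ny → ℝ)
    (hμ0 : ∀ i j, 0 ≤ μ0 i j) (hμ0s : ∀ j, ∑ i, μ0 i j = 1)
    (m Φ : Fin Nx → Fin Ny → ℝ)
    (hm : ∀ i j, 0 ≤ m i j) (hms : ∀ j, ∑ i, m i j = 1)
    (hΦ : ∀ i j, 0 ≤ Φ i j ∧ Φ i j ≤ K) :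
    (∀ i j, 0 ≤ m i j + Δt * Fop δ μ0 m Φ i j) ∧
    (∀ j, ∑ i, (m i j + Δt * Fop δ μ0 m Φ i j) = 1) := by
  have hKp : 0 < δ + K := by
    have := Real.sqrt_nonneg (δ * (δ - 2 * Ubar))
    linarith
  have h1 : Δt * (δ + K) < 1 := (lt_div_iff₀ hKp).mp hΔt
  constructor
  · intro i j
    have hS : ∑ k, Φ k j * m k j ≤ K := by
      calc ∑ k, Φ k j * m k j ≤ ∑ k, K * m k j :=
            Finset.sum_le_sum fun k _ => mul_le_mul_of_nonneg_right (hΦ k j).2 (hm k j)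
        _ = K := by rw [← Finset.mul_sum, hms, mul_one]
    unfold Fop
    generalize ∑ k, Φ k j * m k j = S at hS
    have hδ0 : 0 ≤ δ := by linarith
    have h2 : 0 ≤ Δt * (δ * μ0 i j) :=
      mul_nonneg hΔt0.le (mul_nonneg hδ0 (hμ0 i j))
    have h3 : Δt * (δ - (Φ i j - S)) ≤ Δt * (δ + K) :=
      mul_le_mul_of_nonneg_left (by linarith [(hΦ i j).1]) hΔt0.le
    have h4 : 0 ≤ (1 - Δt * (δ - (Φ i j - S))) * m i j :=
      mul_nonneg (by linarith) (hm i j)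
    linarith
  · intro j
    unfold Fop
    generalize hS : ∑ k, Φ k j * m k j = S
    have h : ∀ i, m i j + Δt * (δ * μ0 i j - (δ - (Φ i j - S)) * m i j)
        = (1 - Δt * δ - Δt * S) * m i j + Δt * δ * μ0 i j + Δt * (Φ i j * m i j) := by
      intro i; ring
    simp only [h, Finset.sum_add_distrib, ← Finset.mul_sum, hms, hμ0s, hS]
    ring
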